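/- Let b > 0, d be a positive natural number, and x, y ∈ ℝ^d. Then ⟨(e^{b|x|²} − 1)x − (e^{b|y|²} − 1)y, x − y⟩ ≥ (1/2)(e^{b|x|²} − 1)|x − y|²; in particular the map x ↦ (e^{b|x|²} − 1)x from ℝ^d to ℝ^d is monotone, i.e., ⟨(e^{b|x|²} − 1)x − (e^{b|y|²} − 1)y, x − y⟩ ≥ 0 for all x, y. -/

import Mathlib

open scoped RealInnerProductSpace

theorem inner_smul_sub_smul_sub {E : Type*} [NormedAddCommGroup E] [InnerProductSpace ℝ E]
    (p q : ℝ) (x y : E) :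
    ⟪p • x - q • y, x - y⟫ =
      (p + q) / 2 * ‖x - y‖ ^ 2 + (p - q) * (‖x‖ ^ 2 - ‖y‖ ^ 2) / 2 := by
  rw [norm_sub_sq_real]
  simp only [inner_sub_left, inner_sub_right, real_inner_smul_left,
    real_inner_self_eq_norm_sq, real_inner_comm x y]
  ring

theorem exp_damping_monotone (b : ℝ) (hb : 0 < b) (d : ℕ) (hd : 0 < d)
    (x y : EuclideanSpace ℝ (Fin d)) :
    ⟪(Real.exp (b * ‖x‖ ^ 2) - 1) • x - (Real.exp (b * ‖y‖ ^ 2) - 1) • y, x - y⟫ ≥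
        (1 / 2) * (Real.exp (b * ‖x‖ ^ 2) - 1) * ‖x - y‖ ^ 2 ∧
    ⟪(Real.exp (b * ‖x‖ ^ 2) - 1) • x - (Real.exp (b * ‖y‖ ^ 2) - 1) • y, x - y⟫ ≥ 0 := by
  have coeff_nonneg (z : EuclideanSpace ℝ (Fin d)) : 0 ≤ Real.exp (b * ‖z‖ ^ 2) - 1 :=
    sub_nonneg.2 (Real.one_le_exp (by positivity))
  have cross_nonneg : 0 ≤ ((Real.exp (b * ‖x‖ ^ 2) - 1) - (Real.exp (b * ‖y‖ ^ 2) - 1)) *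
      (‖x‖ ^ 2 - ‖y‖ ^ 2) := by
    rcases le_total (‖x‖ ^ 2) (‖y‖ ^ 2) with h | h
    · have : Real.exp (b * ‖x‖ ^ 2) ≤ Real.exp (b * ‖y‖ ^ 2) := by gcongr
      exact mul_nonneg_of_nonpos_of_nonpos (by linarith) (by linarith)
    · have : Real.exp (b * ‖y‖ ^ 2) ≤ Real.exp (b * ‖x‖ ^ 2) := by gcongr
      exact mul_nonneg (by linarith) (by linarith)
  have hx := mul_nonneg (coeff_nonneg x) (sq_nonneg ‖x - y‖)
  have hy := mul_nonneg (coeff_nonneg y) (sq_nonneg ‖x - y‖)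
  rw [inner_smul_sub_smul_sub]
  constructor <;> linarith
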